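/- Let α be an automorphism of a finite-dimensional real vector space (or more generally an element of GL_n(ℝ)). Then α admits a unique decomposition α = α_r · α_i where α_r has only positive real eigenvalues, α_i lies in a compact subgroup of GL_n(ℝ), and α_r commutes with α_i. Moreover α_r and α_i commute with every matrix commuting with α. -/

import Mathlib

/-- An element of `GL_n(ℝ)` is *purely positive real* if all its complex
eigenvalues are positive real numbers. -/
def PurelyPositiveReal {n : ℕ} (β : GL (Fin n) ℝ) : Prop :=
  ∀ μ : ℂ, (((β : Matrix (Fin n) (Fin n) ℝ).map (fun x : ℝ => (x : ℂ))).charpoly).IsRoot μ →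
    ∃ r : ℝ, 0 < r ∧ μ = (r : ℂ)

/-- An element of `GL_n(ℝ)` is *elliptic* if it lies in a compact subgroup. -/
def Elliptic {n : ℕ} (β : GL (Fin n) ℝ) : Prop :=
  ∃ C : Subgroup (GL (Fin n) ℝ), IsCompact (C : Set (GL (Fin n) ℝ)) ∧ β ∈ C

namespace RED

open Polynomial Matrix

variable {n : ℕ}

/-- All eigenvalues (via eigenvectors) are positive reals. -/
def PPR (G : Matrix (Fin n) (Fin n) ℂ) : Prop :=
  ∀ (μ : ℂ) (v : Fin n → ℂ), v ≠ 0 → G *ᵥ v = μ • v → ∃ r : ℝ, 0 < r ∧ μ = (r : ℂ)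

/-- Integer powers have bounded entries. -/
def PB (g : GL (Fin n) ℂ) : Prop :=
  ∀ i j, ∃ M : ℝ, ∀ k : ℤ, ‖((g ^ k : GL (Fin n) ℂ) : Matrix (Fin n) (Fin n) ℂ) i j‖ ≤ M

lemma isRoot_iff (G : Matrix (Fin n) (Fin n) ℂ) (μ : ℂ) :
    G.charpoly.IsRoot μ ↔ ∃ v, v ≠ 0 ∧ G *ᵥ v = μ • v := by
  rw [Polynomial.IsRoot, Matrix.eval_charpoly, ← Matrix.exists_mulVec_eq_zero_iff]
  refine exists_congr fun v => and_congr_right fun _ => ?_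
  rw [Matrix.sub_mulVec, sub_eq_zero, Matrix.scalar_apply, ← Matrix.smul_one_eq_diagonal,
    Matrix.smul_mulVec, Matrix.one_mulVec, eq_comm]

lemma pow_mulVec_eig {G : Matrix (Fin n) (Fin n) ℂ} {μ : ℂ} {v : Fin n → ℂ}
    (h : G *ᵥ v = μ • v) (k : ℕ) : (G ^ k) *ᵥ v = μ ^ k • v := by
  induction k with
  | zero => simp
  | succ k ih =>
    rw [pow_succ, ← Matrix.mulVec_mulVec, h, Matrix.mulVec_smul, ih, smul_smul, pow_succ, mul_comm]

lemma aeval_comm {A B : Matrix (Fin n) (Fin n) ℂ} (h : Commute A B) (q : ℂ[X]) :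
    Commute (aeval A q) B := by
  induction q using Polynomial.induction_on' with
  | add p q hp hq => rw [map_add]; exact hp.add_left hq
  | monomial k c =>
    rw [Polynomial.aeval_monomial]
    exact Commute.mul_left (Algebra.commutes c B) (h.pow_left k)

lemma exists_proj (A : Matrix (Fin n) (Fin n) ℂ) :
    ∃ (S : Finset ℂ) (P : ℂ → Matrix (Fin n) (Fin n) ℂ),
      (∀ l ∈ S, A.charpoly.IsRoot l) ∧ (∑ l ∈ S, P l = 1) ∧
      (∀ l ∈ S, ∀ m ∈ S, l ≠ m → P l * P m = 0) ∧
      (∀ l, ∀ B, Commute A B → Commute (P l) B) ∧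
      (∀ l ∈ S, (A - l • 1) ^ n * P l = 0) := by
  classical
  let S := A.charpoly.roots.toFinset
  have hmon := A.charpoly_monic
  have hdvd : A.charpoly ∣ ∏ l ∈ S, (X - C l) ^ n := by
    have h1 := (IsAlgClosed.splits A.charpoly).eq_prod_roots_of_monic hmon
    rw [Finset.prod_multiset_map_count] at h1
    nth_rewrite 1 [h1]
    refine Finset.prod_dvd_prod_of_dvd _ _ fun l _ => pow_dvd_pow _ ?_
    calc _ ≤ Multiset.card A.charpoly.roots := Multiset.count_le_card _ _
      _ ≤ A.charpoly.natDegree := Polynomial.card_roots' _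
      _ = n := by simp
  have hz : ∀ q, (∏ l ∈ S, (X - C l) ^ n) ∣ q → aeval A q = 0 := by
    intro q hq
    obtain ⟨c, rfl⟩ := hdvd.trans hq
    rw [map_mul, Matrix.aeval_self_charpoly, zero_mul]
  have hne : ∀ l : ℂ, l ∈ S → A.charpoly.IsRoot l := by
    intro l hl
    exact (Polynomial.mem_roots'.1 (Multiset.mem_toFinset.1 hl)).2
  have hcop : Pairwise (Function.onFun IsCoprime fun i : S => ((X - C (i : ℂ)) ^ n : ℂ[X])) := by
    intro a b hab
    exact (Polynomial.isCoprime_X_sub_C_of_isUnit_sub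
      (sub_ne_zero.2 (fun h => hab (Subtype.ext h))).isUnit).pow
  rcases S.eq_empty_or_nonempty with hS | hS
  · refine ⟨∅, 0, by simp, ?_, by simp, by simp, by simp⟩
    have := hz 1 (by rw [hS]; simp)
    simpa using this.symm
  obtain ⟨q, hq⟩ := (exists_sum_eq_one_iff_pairwise_coprime
    (s := fun i : ℂ => ((X - C (i : ℂ)) ^ n : ℂ[X])) hS).2 hcop
  refine ⟨S, fun l => aeval A (q l * ∏ j ∈ S \ {l}, (X - C j) ^ n), hne, ?_, ?_, ?_, ?_⟩
  · rw [← map_sum, hq, map_one]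
  · intro l hl m hm hlm
    rw [← map_mul]
    apply hz
    have h1 : (∏ j ∈ S, (X - C j : ℂ[X]) ^ n) = (X - C l) ^ n * ∏ j ∈ S \ {l}, (X - C j) ^ n := by
      rw [Finset.sdiff_singleton_eq_erase, Finset.mul_prod_erase _ (fun j => (X - C j : ℂ[X]) ^ n) hl]
    rw [h1, mul_comm]
    refine mul_dvd_mul (dvd_mul_left _ _) (Dvd.dvd.mul_left ?_ _)
    exact Finset.dvd_prod_of_mem (fun j => (X - C j : ℂ[X]) ^ n) (by simp [hl, hlm])
  · intro l B hB
    exact aeval_comm hB _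
  · intro l hl
    have : (A - l • 1) ^ n = aeval A ((X - C l) ^ n) := by
      simp [Algebra.algebraMap_eq_smul_one]
    rw [this, ← map_mul]
    apply hz
    rw [Finset.sdiff_singleton_eq_erase, mul_left_comm,
      Finset.mul_prod_erase _ (fun j => (X - C j : ℂ[X]) ^ n) hl]
    exact dvd_mul_left _ _

lemma exists_complex (a : GL (Fin n) ℂ) :
    ∃ R E : GL (Fin n) ℂ, a = R * E ∧ PPR (R : Matrix (Fin n) (Fin n) ℂ) ∧ PB E ∧
      ∀ B, Commute a B → Commute R B ∧ Commute E B := by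
  classical
  obtain ⟨S, P, hroot, hsum, horth, hcomm, hnil⟩ := exists_proj (a : Matrix (Fin n) (Fin n) ℂ)
  have hne : ∀ l ∈ S, l ≠ 0 := by
    rintro l hl rfl
    obtain ⟨v, hv, h⟩ := (isRoot_iff _ _).1 (hroot _ hl)
    apply hv
    have : ((a⁻¹ : GL (Fin n) ℂ) : Matrix (Fin n) (Fin n) ℂ) *ᵥ
      ((a : Matrix (Fin n) (Fin n) ℂ) *ᵥ v) = 0 := by rw [h]; simp
    rwa [Matrix.mulVec_mulVec, ← Units.val_mul, inv_mul_cancel, Units.val_one,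
      Matrix.one_mulVec] at this
  let u : ℂ → ℂ := fun l => l / ‖l‖
  have hu0 : ∀ l ∈ S, u l ≠ 0 := fun l hl => by
    have := hne l hl
    simp [u, this]
  have hu1 : ∀ l ∈ S, ‖u l‖ = 1 := fun l hl => by
    have := hne l hl
    simp [u, this]
  have hidem : ∀ l ∈ S, P l * P l = P l := by
    intro l hl
    conv_rhs => rw [← mul_one (P l), ← hsum, Finset.mul_sum]
    rw [Finset.sum_eq_single_of_mem l hl]
    intro m hm hml
    exact horth l hl m hm hml.symm
  have hDP : ∀ (f : ℂ → ℂ), ∀ l ∈ S, (∑ m ∈ S, f m • P m) * P l = f l • P l := by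
    intro f l hl
    rw [Finset.sum_mul, Finset.sum_eq_single_of_mem l hl]
    · rw [smul_mul_assoc, hidem l hl]
    · intro m hm hml
      rw [smul_mul_assoc, horth m hm l hl hml, smul_zero]
  let φ : Multiplicative ℤ →* Matrix (Fin n) (Fin n) ℂ :=
    { toFun := fun k => ∑ l ∈ S, (u l) ^ (Multiplicative.toAdd k) • P l
      map_one' := by simpa using hsum
      map_mul' := by
        intro j k
        rw [Finset.mul_sum]
        refine Finset.sum_congr rfl fun l hl => ?_
        rw [mul_smul_comm, hDP (fun m => u m ^ (Multiplicative.toAdd j)) l hl, smul_smul, toAdd_mul,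
          zpow_add₀ (hu0 l hl), mul_comm] }
  have hφ : ∀ k, φ k = ∑ l ∈ S, (u l) ^ (Multiplicative.toAdd k) • P l := fun k => rfl
  let E : GL (Fin n) ℂ := φ.toHomUnits (Multiplicative.ofAdd 1)
  have hEk : ∀ k : ℤ, ((E ^ k : GL (Fin n) ℂ) : Matrix (Fin n) (Fin n) ℂ)
      = ∑ l ∈ S, (u l) ^ k • P l := by
    intro k
    have : E ^ k = φ.toHomUnits (Multiplicative.ofAdd k) := by
      rw [← map_zpow, ← ofAdd_zsmul]; simp
    rw [this, MonoidHom.coe_toHomUnits, hφ, toAdd_ofAdd]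
  have hE : (E : Matrix (Fin n) (Fin n) ℂ) = ∑ l ∈ S, u l • P l := by
    simpa using hEk 1
  have hEc : ∀ B, Commute a B → Commute E B := by
    intro B hB
    have hB' : Commute (a : Matrix (Fin n) (Fin n) ℂ) (B : Matrix (Fin n) (Fin n) ℂ) :=
      Commute.units_val_iff.2 hB
    apply Commute.units_val_iff.1
    rw [hE]
    exact Commute.sum_left _ _ _ fun l _ => (hcomm l _ hB').smul_left _
  have haE := hEc a (Commute.refl a)
  refine ⟨a * E⁻¹, E, by simp, ?_, ?_, ?_⟩
  · intro μ v hv h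
    obtain ⟨l, hl, hw⟩ : ∃ l ∈ S, P l *ᵥ v ≠ 0 := by
      by_contra! hcon
      apply hv
      rw [← Matrix.one_mulVec v, ← hsum, Matrix.sum_mulVec]
      exact Finset.sum_eq_zero hcon
    have hPa : Commute (P l) (a : Matrix (Fin n) (Fin n) ℂ) := hcomm l _ (Commute.refl _)
    have hPE : Commute (P l) (E : Matrix (Fin n) (Fin n) ℂ) :=
      hcomm l _ (Commute.units_val_iff.2 haE.symm)
    have hEw : (E : Matrix (Fin n) (Fin n) ℂ) *ᵥ (P l *ᵥ v) = u l • (P l *ᵥ v) := by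
      rw [Matrix.mulVec_mulVec, hE, hDP u l hl, Matrix.smul_mulVec]
    have hav : (a : Matrix (Fin n) (Fin n) ℂ) *ᵥ v
        = μ • ((E : Matrix (Fin n) (Fin n) ℂ) *ᵥ v) := by
      rw [← Matrix.mulVec_smul, ← h, Matrix.mulVec_mulVec, ← Units.val_mul]
      congr 2
      rw [← mul_assoc, haE.eq]; simp
    have haw : (a : Matrix (Fin n) (Fin n) ℂ) *ᵥ (P l *ᵥ v) = (μ * u l) • (P l *ᵥ v) := by
      rw [Matrix.mulVec_mulVec, ← hPa.eq, ← Matrix.mulVec_mulVec, hav, Matrix.mulVec_smul,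
        Matrix.mulVec_mulVec, hPE.eq, ← Matrix.mulVec_mulVec, hEw, smul_smul]
    have h2 : ((a : Matrix (Fin n) (Fin n) ℂ) - l • 1) *ᵥ (P l *ᵥ v)
        = (μ * u l - l) • (P l *ᵥ v) := by
      rw [Matrix.sub_mulVec, haw, Matrix.smul_mulVec, Matrix.one_mulVec, sub_smul]
    have h3 := pow_mulVec_eig h2 n
    rw [Matrix.mulVec_mulVec, hnil l hl, Matrix.zero_mulVec, eq_comm, smul_eq_zero] at h3
    have h4 : μ * u l - l = 0 := eq_zero_of_pow_eq_zero (h3.resolve_right hw)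
    have hl0 := hne l hl
    refine ⟨‖l‖, norm_pos_iff.2 hl0, ?_⟩
    have h5 : (‖l‖ : ℂ) ≠ 0 := by simpa using hl0
    simp only [u] at h4
    field_simp at h4
    have h6 : l * (μ - ‖l‖) = 0 := by linear_combination h4
    exact sub_eq_zero.1 ((mul_eq_zero.1 h6).resolve_left hl0)
  · intro i j
    refine ⟨∑ l ∈ S, ‖P l i j‖, fun k => ?_⟩
    rw [hEk, Matrix.sum_apply]
    refine (norm_sum_le _ _).trans (Finset.sum_le_sum fun l hl => ?_)
    rw [Matrix.smul_apply, norm_smul, norm_zpow, hu1 l hl, _root_.one_zpow, one_mul]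
  · intro B hB
    exact ⟨hB.mul_left (hEc B hB).inv_left, hEc B hB⟩

lemma PB.inv {g : GL (Fin n) ℂ} (h : PB g) : PB g⁻¹ := by
  intro i j
  obtain ⟨M, hM⟩ := h i j
  exact ⟨M, fun k => by simpa using hM (-k)⟩

lemma PB.mul {g h : GL (Fin n) ℂ} (hg : PB g) (hh : PB h) (hc : Commute g h) : PB (g * h) := by
  intro i j
  choose M hM using hg
  choose N hN using hh
  refine ⟨∑ l, M i l * N l j, fun k => ?_⟩
  rw [hc.mul_zpow, Units.val_mul, Matrix.mul_apply]
  refine (norm_sum_le _ _).trans (Finset.sum_le_sum fun l _ => ?_)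
  rw [norm_mul]
  exact mul_le_mul (hM _ _ _) (hN _ _ _) (norm_nonneg _) ((norm_nonneg _).trans (hM i l 0))

lemma PB.norm_le {g : GL (Fin n) ℂ} (h : PB g) {μ : ℂ} {v : Fin n → ℂ} (hv : v ≠ 0)
    (he : (g : Matrix (Fin n) (Fin n) ℂ) *ᵥ v = μ • v) : ‖μ‖ ≤ 1 := by
  obtain ⟨i, hi⟩ := Function.ne_iff.1 hv
  choose M hM using h
  by_contra! hlt
  obtain ⟨k, hk⟩ := pow_unbounded_of_one_lt ((∑ j, M i j * ‖v j‖) / ‖v i‖) hlt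
  have hpos : 0 < ‖v i‖ := norm_pos_iff.2 hi
  rw [div_lt_iff₀ hpos, ← norm_pow, ← norm_mul] at hk
  have h1 := congrFun (pow_mulVec_eig he k) i
  rw [Pi.smul_apply, smul_eq_mul] at h1
  rw [← h1] at hk
  refine absurd hk (not_lt.2 ?_)
  rw [Matrix.mulVec, dotProduct]
  refine (norm_sum_le _ _).trans (Finset.sum_le_sum fun j _ => ?_)
  rw [norm_mul]
  have := hM i j k
  rw [zpow_natCast, Units.val_pow_eq_pow_val] at this
  gcongr

lemma inv_eig {g : GL (Fin n) ℂ} {μ : ℂ} {v : Fin n → ℂ} (hμ : μ ≠ 0)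
    (he : (g : Matrix (Fin n) (Fin n) ℂ) *ᵥ v = μ • v) :
    ((g⁻¹ : GL (Fin n) ℂ) : Matrix (Fin n) (Fin n) ℂ) *ᵥ v = μ⁻¹ • v := by
  have h1 : ((g⁻¹ : GL (Fin n) ℂ) : Matrix (Fin n) (Fin n) ℂ) *ᵥ
      ((g : Matrix (Fin n) (Fin n) ℂ) *ᵥ v) = v := by
    rw [Matrix.mulVec_mulVec, ← Units.val_mul, inv_mul_cancel, Units.val_one, Matrix.one_mulVec]
  rw [he, Matrix.mulVec_smul] at h1
  rw [← h1, smul_smul, inv_mul_cancel₀ hμ, one_smul, h1]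

lemma eq_one_of_PB_PPR {g : GL (Fin n) ℂ} (hb : PB g)
    (hp : PPR (g : Matrix (Fin n) (Fin n) ℂ)) : g = 1 := by
  have heig : ∀ μ ∈ (g : Matrix (Fin n) (Fin n) ℂ).charpoly.roots, μ = 1 := by
    intro μ hμ
    obtain ⟨v, hv, he⟩ := (isRoot_iff _ _).1 (Polynomial.mem_roots'.1 hμ).2
    obtain ⟨r, hr, rfl⟩ := hp μ v hv he
    have hr0 : (r : ℂ) ≠ 0 := by exact_mod_cast hr.ne'
    have h1 := hb.norm_le hv he
    have h2 := hb.inv.norm_le hv (inv_eig hr0 he)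
    rw [norm_inv, Complex.norm_real, Real.norm_of_nonneg hr.le] at h2
    rw [Complex.norm_real, Real.norm_of_nonneg hr.le] at h1
    have h3 := (inv_le_one₀ hr).1 h2
    have : r = 1 := le_antisymm h1 h3
    simp [this]
  have hnil : IsNilpotent ((g : Matrix (Fin n) (Fin n) ℂ) - 1) := by
    have h1 := (IsAlgClosed.splits (g : Matrix (Fin n) (Fin n) ℂ).charpoly).eq_prod_roots_of_monic
      (Matrix.charpoly_monic _)
    rw [Multiset.eq_replicate_card.2 heig, Multiset.map_replicate, Multiset.prod_replicate] at h1
    have h2 := Matrix.aeval_self_charpoly (g : Matrix (Fin n) (Fin n) ℂ)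
    rw [h1] at h2
    exact ⟨_, by simpa using h2⟩
  by_contra hg
  set N := (g : Matrix (Fin n) (Fin n) ℂ) - 1 with hN
  have hgN : (g : Matrix (Fin n) (Fin n) ℂ) = 1 + N := by simp [hN]
  have hN0 : N ≠ 0 := fun h => hg (Units.ext (by simpa using sub_eq_zero.1 (hN.symm.trans h)))
  -- minimal exponent
  obtain ⟨j, hj1, hj0⟩ : ∃ j, N ^ (j + 1) ≠ 0 ∧ N ^ (j + 2) = 0 := by
    classical
    let m := Nat.find hnil
    have hm : N ^ m = 0 := Nat.find_spec hnil
    have hm2 : 2 ≤ m := by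
      by_contra! hlt
      apply hN0
      have : N ^ 1 = 0 := pow_eq_zero_of_le (by omega) hm
      simpa using this
    refine ⟨m - 2, ?_, ?_⟩
    · exact Nat.find_min hnil (m := m - 2 + 1) (by omega)
    · rwa [show m - 2 + 2 = m by omega]
  have hk : ∀ k : ℕ, (g : Matrix (Fin n) (Fin n) ℂ) ^ k * N ^ j = N ^ j + (k : ℂ) • N ^ (j + 1) := by
    intro k
    induction k with
    | zero => simp
    | succ k ih =>
      rw [pow_succ', mul_assoc, ih, hgN, add_mul, one_mul, mul_add, mul_smul_comm, ← pow_succ',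
        ← pow_succ', hj0, smul_zero, add_zero]
      push_cast
      rw [add_smul, one_smul, add_assoc]
  obtain ⟨a, b, hab⟩ : ∃ a b, (N ^ (j + 1)) a b ≠ 0 := by
    by_contra! hcon
    exact hj1 (Matrix.ext hcon)
  choose M hM using hb
  have hbound : ∀ k : ℕ, (k : ℝ) * ‖(N ^ (j + 1)) a b‖ ≤
      ∑ l, M a l * ‖(N ^ j) l b‖ + ‖(N ^ j) a b‖ := by
    intro k
    have h1 : (k : ℂ) * (N ^ (j + 1)) a b =
        ((g : Matrix (Fin n) (Fin n) ℂ) ^ k * N ^ j) a b - (N ^ j) a b := by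
      rw [hk]; simp
    have h2 := congrArg norm h1
    rw [norm_mul, Complex.norm_natCast] at h2
    rw [h2]
    refine (norm_sub_le _ _).trans (add_le_add_left ?_ _)
    rw [Matrix.mul_apply]
    refine (norm_sum_le _ _).trans (Finset.sum_le_sum fun l _ => ?_)
    rw [norm_mul]
    have := hM a l k
    rw [zpow_natCast, Units.val_pow_eq_pow_val] at this
    gcongr
  have hpos : 0 < ‖(N ^ (j + 1)) a b‖ := norm_pos_iff.2 hab
  obtain ⟨k, hk⟩ := exists_nat_gt ((∑ l, M a l * ‖(N ^ j) l b‖ + ‖(N ^ j) a b‖) /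
    ‖(N ^ (j + 1)) a b‖)
  rw [div_lt_iff₀ hpos] at hk
  exact absurd hk (not_lt.2 (hbound k))

lemma exists_common {G R : Matrix (Fin n) (Fin n) ℂ} (hc : Commute G R) {μ : ℂ} {v : Fin n → ℂ}
    (hv : v ≠ 0) (he : G *ᵥ v = μ • v) :
    ∃ (r : ℂ) (w : Fin n → ℂ), w ≠ 0 ∧ G *ᵥ w = μ • w ∧ R *ᵥ w = r • w := by
  let W : Submodule ℂ (Fin n → ℂ) := LinearMap.ker (G.mulVecLin - μ • LinearMap.id)
  have hW : ∀ w, w ∈ W ↔ G *ᵥ w = μ • w := by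
    intro w
    simp [W, sub_eq_zero]
  have hinv : ∀ w ∈ W, R.mulVecLin w ∈ W := by
    intro w hw
    rw [hW] at hw ⊢
    rw [Matrix.mulVecLin_apply, Matrix.mulVec_mulVec, hc.eq, ← Matrix.mulVec_mulVec, hw,
      Matrix.mulVec_smul]
  have : Nontrivial W := ⟨⟨⟨v, (hW v).2 he⟩, 0, fun h => hv (congrArg Subtype.val h)⟩⟩
  obtain ⟨r, hr⟩ := Module.End.exists_eigenvalue (R.mulVecLin.restrict hinv)
  obtain ⟨w, hw⟩ := hr.exists_hasEigenvector
  refine ⟨r, w, fun h => hw.2 (Subtype.ext h), (hW w).1 w.2, ?_⟩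
  have := congrArg Subtype.val hw.apply_eq_smul
  simpa using this

lemma unique_complex {R E R' E' : GL (Fin n) ℂ} (h : R * E = R' * E')
    (hR : PPR (R : Matrix (Fin n) (Fin n) ℂ)) (hR' : PPR (R' : Matrix (Fin n) (Fin n) ℂ))
    (hE : PB E) (hE' : PB E') (hRR : Commute R R') (hEE : Commute E E') :
    R = R' ∧ E = E' := by
  have hg : R'⁻¹ * R = E' * E⁻¹ := by
    rw [inv_mul_eq_iff_eq_mul, ← mul_assoc, ← h]; simp
  have h1 : R'⁻¹ * R = 1 := by
    apply eq_one_of_PB_PPR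
    · rw [hg]
      exact hE'.mul hE.inv hEE.symm.inv_right
    · intro μ v hv he
      have hc : Commute (R'⁻¹ * R) R := hRR.symm.inv_left.mul_left (Commute.refl R)
      obtain ⟨r, w, hw, hgw, hRw⟩ := exists_common (Commute.units_val_iff.2 hc) hv he
      obtain ⟨s, hs, rfl⟩ := hR r w hw hRw
      have hs0 : (s : ℂ) ≠ 0 := by exact_mod_cast hs.ne'
      rw [Units.val_mul, ← Matrix.mulVec_mulVec, hRw, Matrix.mulVec_smul] at hgw
      have h2 : (R' : Matrix (Fin n) (Fin n) ℂ) *ᵥ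
          (((R'⁻¹ : GL (Fin n) ℂ) : Matrix (Fin n) (Fin n) ℂ) *ᵥ w) = w := by
        rw [Matrix.mulVec_mulVec, ← Units.val_mul, mul_inv_cancel, Units.val_one,
          Matrix.one_mulVec]
      have h3 : ((R'⁻¹ : GL (Fin n) ℂ) : Matrix (Fin n) (Fin n) ℂ) *ᵥ w
          = ((s : ℂ)⁻¹ * μ) • w := by
        rw [mul_smul, ← hgw, smul_smul, inv_mul_cancel₀ hs0, one_smul]
      have hne : (s : ℂ)⁻¹ * μ ≠ 0 := by
        intro h0
        rw [h3, h0, zero_smul, Matrix.mulVec_zero] at h2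
        exact hw h2.symm
      have h4 := inv_eig hne h3
      rw [inv_inv] at h4
      obtain ⟨t, ht, h5⟩ := hR' _ w hw h4
      refine ⟨s / t, by positivity, ?_⟩
      have ht0 : (t : ℂ) ≠ 0 := by exact_mod_cast ht.ne'
      rw [inv_eq_iff_eq_inv] at h5
      push_cast
      field_simp at h5 ⊢
      linear_combination h5
  have h2 : R = R' := by rw [inv_mul_eq_one] at h1; exact h1.symm
  refine ⟨h2, ?_⟩
  rw [h2] at h
  exact mul_left_cancel h

/-- complexification -/
noncomputable abbrev cx : GL (Fin n) ℝ →* GL (Fin n) ℂ :=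
  Matrix.GeneralLinearGroup.map Complex.ofRealHom

/-- complex conjugation -/
noncomputable abbrev cj : GL (Fin n) ℂ →* GL (Fin n) ℂ :=
  Matrix.GeneralLinearGroup.map (starRingEnd ℂ)

lemma cx_apply (g : GL (Fin n) ℝ) (i j : Fin n) : cx g i j = (g i j : ℂ) := rfl

lemma cj_apply (g : GL (Fin n) ℂ) (i j : Fin n) : cj g i j = (starRingEnd ℂ) (g i j) := rfl

lemma cx_injective : Function.Injective (cx : GL (Fin n) ℝ → GL (Fin n) ℂ) := by
  intro g h hgh
  ext i j
  have := congrArg (fun x : GL (Fin n) ℂ => x i j) hgh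
  exact Complex.ofReal_injective this

lemma cj_cx (g : GL (Fin n) ℝ) : cj (cx g) = cx g := by
  ext i j
  rw [cj_apply, cx_apply, Complex.conj_ofReal]

lemma commute_cx {g h : GL (Fin n) ℝ} : Commute (cx g) (cx h) ↔ Commute g h := by
  constructor
  · intro hc
    exact cx_injective (by rw [map_mul, map_mul]; exact hc.eq)
  · exact fun hc => hc.map cx

lemma exists_real {g : GL (Fin n) ℂ} (h : cj g = g) : ∃ g₀ : GL (Fin n) ℝ, cx g₀ = g := by
  have key : ∀ k : GL (Fin n) ℂ, cj k = k →
      ((k : Matrix (Fin n) (Fin n) ℂ).map Complex.re).map (Complex.ofRealHom)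
        = (k : Matrix (Fin n) (Fin n) ℂ) := by
    intro k hk
    ext i j
    have := congrArg (fun x : GL (Fin n) ℂ => x i j) hk
    exact Complex.conj_eq_iff_re.1 this
  have hinv : cj g⁻¹ = g⁻¹ := by rw [map_inv, h]
  have hinj : Function.Injective (fun M : Matrix (Fin n) (Fin n) ℝ => M.map Complex.ofRealHom) :=
    Matrix.map_injective Complex.ofReal_injective
  refine ⟨⟨(g : Matrix (Fin n) (Fin n) ℂ).map Complex.re,
    ((g⁻¹ : GL (Fin n) ℂ) : Matrix (Fin n) (Fin n) ℂ).map Complex.re, ?_, ?_⟩, ?_⟩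
  · apply hinj
    simp only [Matrix.map_mul]
    rw [key g h, key _ hinv, ← Units.val_mul]
    simp
  · apply hinj
    simp only [Matrix.map_mul]
    rw [key g h, key _ hinv, ← Units.val_mul]
    simp
  · apply Units.ext
    exact key g h

lemma PPR_iff (g : GL (Fin n) ℝ) :
    PurelyPositiveReal g ↔ PPR (cx g : Matrix (Fin n) (Fin n) ℂ) := by
  constructor
  · intro h μ v hv he
    exact h μ ((isRoot_iff _ _).2 ⟨v, hv, he⟩)
  · intro h μ hμ
    obtain ⟨v, hv, he⟩ := (isRoot_iff _ _).1 hμ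
    exact h μ v hv he

lemma PPR.cj {g : GL (Fin n) ℂ} (h : PPR (g : Matrix (Fin n) (Fin n) ℂ)) :
    PPR (cj g : Matrix (Fin n) (Fin n) ℂ) := by
  intro μ v hv he
  have hstar : (g : Matrix (Fin n) (Fin n) ℂ) *ᵥ (star v) = (starRingEnd ℂ μ) • star v := by
    ext i
    have := congrArg (starRingEnd ℂ) (congrFun he i)
    simp only [Matrix.mulVec, dotProduct, map_sum, map_mul, cj_apply, Complex.conj_conj,
      Pi.smul_apply, smul_eq_mul] at this
    simpa [Matrix.mulVec, dotProduct] using this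
  obtain ⟨r, hr, h1⟩ := h _ (star v) (by simpa using hv) hstar
  refine ⟨r, hr, ?_⟩
  rw [← Complex.conj_conj μ, h1, Complex.conj_ofReal]

lemma PB.cj {g : GL (Fin n) ℂ} (h : PB g) : PB (cj g) := by
  intro i j
  obtain ⟨M, hM⟩ := h i j
  refine ⟨M, fun k => ?_⟩
  rw [← map_zpow, cj_apply, RCLike.norm_conj]
  exact hM k

lemma PB_of_elliptic {g : GL (Fin n) ℝ} (h : Elliptic g) : PB (cx g) := by
  obtain ⟨C, hC, hg⟩ := h
  intro i j
  have hcont : Continuous fun x : GL (Fin n) ℝ => (x : Matrix (Fin n) (Fin n) ℝ) i j :=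
    (Units.continuous_val).matrix_elem i j
  obtain ⟨M, hM⟩ := hC.exists_bound_of_continuousOn hcont.continuousOn
  refine ⟨M, fun k => ?_⟩
  rw [← map_zpow, cx_apply, Complex.norm_real]
  exact hM _ (C.zpow_mem hg k)

lemma elliptic_of_PB {g : GL (Fin n) ℝ} (h : PB (cx g)) : Elliptic g := by
  choose M hM using h
  let K : Set (Matrix (Fin n) (Fin n) ℝ) :=
    Set.pi Set.univ fun i => Set.pi Set.univ fun j => Metric.closedBall 0 (M i j)
  have hK : IsCompact K :=
    isCompact_univ_pi fun i => isCompact_univ_pi fun j => isCompact_closedBall _ _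
  have hKo : IsCompact (MulOpposite.op '' K) := hK.image MulOpposite.continuous_op
  have hcomp := Units.isClosedEmbedding_embedProduct.isCompact_preimage (hK.prod hKo)
  have hmem : ∀ k : ℤ, ((g ^ k : GL (Fin n) ℝ) : Matrix (Fin n) (Fin n) ℝ) ∈ K := by
    intro k i _ j _
    have := hM i j k
    rw [← map_zpow, cx_apply, Complex.norm_real] at this
    simpa using this
  refine ⟨(Subgroup.zpowers g).topologicalClosure, ?_,
    Subgroup.le_topologicalClosure _ (Subgroup.mem_zpowers g)⟩
  refine hcomp.of_isClosed_subset (Subgroup.isClosed_topologicalClosure _) ?_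
  rw [Subgroup.topologicalClosure_coe]
  refine closure_minimal ?_ hcomp.isClosed
  rintro _ ⟨k, rfl⟩
  refine ⟨hmem k, Set.mem_image_of_mem _ ?_⟩
  simpa using hmem (-k)

lemma exists_main (α : GL (Fin n) ℝ) :
    ∃ R E : GL (Fin n) ℝ, (α = R * E ∧ PurelyPositiveReal R ∧ Elliptic E ∧ Commute R E) ∧
      ∀ B, Commute α B → Commute R B ∧ Commute E B := by
  obtain ⟨R, E, h, hR, hE, hc⟩ := exists_complex (cx α)
  have h' : cx α = cj R * cj E := by rw [← map_mul, ← h, cj_cx]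
  have hcomm : Commute R E := by
    have h1 := (hc (cx α) (Commute.refl _)).2
    exact (hc E h1.symm).1
  have hcomm' : Commute (cj R) (cj E) := hcomm.map cj
  have hR1 : Commute (cx α) (cj R) := by
    rw [h']; exact (Commute.refl _).mul_left hcomm'.symm
  have hE1 : Commute (cx α) (cj E) := by
    rw [h']; exact hcomm'.mul_left (Commute.refl _)
  obtain ⟨h1, h2⟩ := unique_complex (h.symm.trans h') hR hR.cj hE hE.cj (hc _ hR1).1 (hc _ hE1).2
  obtain ⟨R₀, rfl⟩ := exists_real h1.symm
  obtain ⟨E₀, rfl⟩ := exists_real h2.symm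
  refine ⟨R₀, E₀, ⟨cx_injective (by rw [h, map_mul]), (PPR_iff _).2 hR, elliptic_of_PB hE,
    commute_cx.1 hcomm⟩, fun B hB => ?_⟩
  obtain ⟨h3, h4⟩ := hc (cx B) (commute_cx.2 hB)
  exact ⟨commute_cx.1 h3, commute_cx.1 h4⟩

end RED

/-- Every `α ∈ GL_n(ℝ)` admits a unique decomposition `α = α_r · α_i` with `α_r`
purely positive real, `α_i` elliptic, and `α_r` commuting with `α_i`; moreover
`α_r` and `α_i` commute with every element commuting with `α`. -/
theorem exists_unique_real_elliptic_decomposition {n : ℕ} (α : GL (Fin n) ℝ) :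
    (∃! p : GL (Fin n) ℝ × GL (Fin n) ℝ,
      α = p.1 * p.2 ∧ PurelyPositiveReal p.1 ∧ Elliptic p.2 ∧ Commute p.1 p.2) ∧
    (∀ p : GL (Fin n) ℝ × GL (Fin n) ℝ,
      α = p.1 * p.2 ∧ PurelyPositiveReal p.1 ∧ Elliptic p.2 ∧ Commute p.1 p.2 →
      ∀ B : GL (Fin n) ℝ, Commute α B → Commute p.1 B ∧ Commute p.2 B) := by
  obtain ⟨R, E, hRE, hc⟩ := RED.exists_main α
  have huniq : ∀ p : GL (Fin n) ℝ × GL (Fin n) ℝ,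
      α = p.1 * p.2 ∧ PurelyPositiveReal p.1 ∧ Elliptic p.2 ∧ Commute p.1 p.2 → p = (R, E) := by
    rintro ⟨R', E'⟩ ⟨h, hR, hE, hcomm⟩
    dsimp only at h hR hE hcomm
    have hR1 : Commute α R' := by
      rw [h]; exact (Commute.refl _).mul_left hcomm.symm
    have hE1 : Commute α E' := by
      rw [h]; exact hcomm.mul_left (Commute.refl _)
    obtain ⟨h1, h2⟩ := RED.unique_complex (R := RED.cx R) (E := RED.cx E) (R' := RED.cx R')
      (E' := RED.cx E') ((map_mul RED.cx R E).symm.trans ((congrArg RED.cx (hRE.1.symm.trans h)).trans (map_mul _ _ _)))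
      ((RED.PPR_iff _).1 hRE.2.1) ((RED.PPR_iff _).1 hR) (RED.PB_of_elliptic hRE.2.2.1)
      (RED.PB_of_elliptic hE) (RED.commute_cx.2 (hc _ hR1).1) (RED.commute_cx.2 (hc _ hE1).2)
    rw [RED.cx_injective h1, RED.cx_injective h2]
  refine ⟨⟨(R, E), hRE, huniq⟩, ?_⟩
  intro p hp B hB
  rw [huniq p hp]
  exact hc B hB
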